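/- Consider Matching Pennies with step size η = 1 and initial payoff vectors y₁⁰ = y₂⁰ = (1, 0), with both players updating by gradient descent. For every n ≥ 0 and k ∈ {0, …, n}, player 1's regret at iteration t = n(n+1)/2 + k satisfies (n − 1)/2 ≤ Regret₁(t) ≤ (n + 3)/2. -/

import Mathlib

open Finset

/-- The probability simplex in `ℝ²`. -/
def simplex2 : Set (Fin 2 → ℝ) :=
  {x | 0 ≤ x 0 ∧ 0 ≤ x 1 ∧ x 0 + x 1 = 1}

/-- Dot product on `ℝ²`. -/
noncomputable def dot2 (x y : Fin 2 → ℝ) : ℝ := x 0 * y 0 + x 1 * y 1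

/-- The objective `y·x - ‖x‖₂²/(2η)` maximized at each gradient descent step. -/
noncomputable def gdObj (η : ℝ) (y x : Fin 2 → ℝ) : ℝ :=
  dot2 y x - (x 0 ^ 2 + x 1 ^ 2) / (2 * η)

/-- `x` is the (unique) maximizer over the simplex of `z ↦ y·z - ‖z‖₂²/(2η)`. -/
def IsGDArgmax (η : ℝ) (y x : Fin 2 → ℝ) : Prop :=
  x ∈ simplex2 ∧ ∀ z ∈ simplex2, gdObj η y z ≤ gdObj η y x

/-- Gradient descent dynamics in the 2x2 zero-sum game `A` with step size `η`
and initial payoff vectors `y10`, `y20`. -/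
structure GD2 (A : Matrix (Fin 2) (Fin 2) ℝ) (η : ℝ) (y10 y20 : Fin 2 → ℝ) where
  x1 : ℕ → Fin 2 → ℝ
  x2 : ℕ → Fin 2 → ℝ
  y1 : ℕ → Fin 2 → ℝ
  y2 : ℕ → Fin 2 → ℝ
  y1_zero : y1 0 = y10
  y2_zero : y2 0 = y20
  x1_argmax : ∀ t, IsGDArgmax η (y1 t) (x1 t)
  x2_argmax : ∀ t, IsGDArgmax η (y2 t) (x2 t)
  y1_succ : ∀ t, y1 (t + 1) = y1 t + A.mulVec (x2 t)
  y2_succ : ∀ t, y2 (t + 1) = y2 t - A.transpose.mulVec (x1 t)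

/-- Player 1's regret after `T` iterations. -/
noncomputable def regret1 (A : Matrix (Fin 2) (Fin 2) ℝ) (x1 x2 : ℕ → Fin 2 → ℝ) (T : ℕ) : ℝ :=
  sSup ((fun x => ∑ t ∈ Finset.range (T + 1), dot2 x (A.mulVec (x2 t))) '' simplex2)
    - ∑ t ∈ Finset.range (T + 1), dot2 (x1 t) (A.mulVec (x2 t))

/-- A player whose first payoff leads by at least the step size plays the first pure strategy. -/
lemma IsGDArgmax.sub_eq_one {y x : Fin 2 → ℝ} (h : IsGDArgmax 1 y x) (hy : 1 ≤ y 0 - y 1) :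
    x 0 - x 1 = 1 := by
  obtain ⟨⟨h0, h1, hs⟩, hmax⟩ := h
  have hle := hmax ![1, 0] (by simp [simplex2])
  simp only [gdObj, dot2, Matrix.cons_val_zero, Matrix.cons_val_one] at hle
  have hx : x 0 = 1 - x 1 := by linarith
  rw [hx] at hle ⊢
  have hz : x 1 = 0 := by
    have : x 1 ^ 2 ≤ 0 := by nlinarith [mul_nonneg h1 (sub_nonneg.2 hy)]
    exact pow_eq_zero_iff two_ne_zero |>.1 (le_antisymm this (sq_nonneg _))
  rw [hz]; norm_num

/-- A player whose second payoff leads by at least the step size plays the second pure strategy. -/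
lemma IsGDArgmax.sub_eq_neg_one {y x : Fin 2 → ℝ} (h : IsGDArgmax 1 y x)
    (hy : y 0 - y 1 ≤ -1) : x 0 - x 1 = -1 := by
  obtain ⟨⟨h0, h1, hs⟩, hmax⟩ := h
  have hle := hmax ![0, 1] (by simp [simplex2])
  simp only [gdObj, dot2, Matrix.cons_val_zero, Matrix.cons_val_one] at hle
  have hx : x 1 = 1 - x 0 := by linarith
  rw [hx] at hle ⊢
  have hz : x 0 = 0 := by
    have : x 0 ^ 2 ≤ 0 := by nlinarith [mul_nonneg h0 (sub_nonneg.2 hy)]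
    exact pow_eq_zero_iff two_ne_zero |>.1 (le_antisymm this (sq_nonneg _))
  rw [hz]; norm_num

lemma dot2_matchingPennies (x z : Fin 2 → ℝ) :
    dot2 x (!![(1 : ℝ), -1; -1, 1].mulVec z) = (x 0 - x 1) * (z 0 - z 1) := by
  simp [dot2, Matrix.mulVec, dotProduct, Fin.sum_univ_two]
  ring

/-- In Matching Pennies the best fixed strategy in hindsight earns `|∑ (x₂ᵗ 0 - x₂ᵗ 1)|`. -/
lemma regret1_matchingPennies (x1 x2 : ℕ → Fin 2 → ℝ) (T : ℕ) :
    regret1 !![(1 : ℝ), -1; -1, 1] x1 x2 T =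
      |∑ t ∈ range (T + 1), (x2 t 0 - x2 t 1)|
        - ∑ t ∈ range (T + 1), (x1 t 0 - x1 t 1) * (x2 t 0 - x2 t 1) := by
  simp only [regret1, dot2_matchingPennies, ← mul_sum]
  congr 1
  set S := ∑ t ∈ range (T + 1), (x2 t 0 - x2 t 1)
  apply IsGreatest.csSup_eq
  constructor
  · rcases abs_cases S with ⟨h, -⟩ | ⟨h, -⟩
    · exact ⟨![1, 0], by simp [simplex2], by simp [h]⟩
    · exact ⟨![0, 1], by simp [simplex2], by simp [h]⟩
  · rintro _ ⟨x, ⟨h0, h1, hs⟩, rfl⟩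
    have hx : |x 0 - x 1| ≤ 1 := abs_le.2 ⟨by linarith, by linarith⟩
    calc (x 0 - x 1) * S ≤ |(x 0 - x 1) * S| := le_abs_self _
      _ = |x 0 - x 1| * |S| := abs_mul _ _
      _ ≤ |S| := mul_le_of_le_one_left (abs_nonneg S) hx

/-- The state at step `k` of phase `n` of the Matching Pennies dynamics: `a` and `b` are the payoff
differences of the two players, `p` is the utility player 1 has accumulated so far. -/
def PhaseState (n k : ℕ) (a b p : ℝ) : Prop :=
  (n % 4 = 0 ∧ a = 2 * k + 1 ∧ b = 2 * (n - k) + 1 ∧ p = k - n / 2) ∨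
  (n % 4 = 1 ∧ a = 2 * (n - k) + 1 ∧ b = -(2 * k + 1) ∧ p = (n + 1) / 2 - k) ∨
  (n % 4 = 2 ∧ a = -(2 * k + 1) ∧ b = -(2 * (n - k) + 1) ∧ p = k - n / 2) ∨
  (n % 4 = 3 ∧ a = -(2 * (n - k) + 1) ∧ b = 2 * k + 1 ∧ p = (n + 1) / 2 - k)

/-- `s` is the pure strategy, as a sign, played at payoff difference `a`. -/
def IsSignResponse (a s : ℝ) : Prop := (1 ≤ a → s = 1) ∧ (a ≤ -1 → s = -1)

lemma IsGDArgmax.isSignResponse {y x : Fin 2 → ℝ} (h : IsGDArgmax 1 y x) :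
    IsSignResponse (y 0 - y 1) (x 0 - x 1) :=
  ⟨h.sub_eq_one, h.sub_eq_neg_one⟩

lemma PhaseState.signs {n k : ℕ} {a b p s r : ℝ} (h : PhaseState n k a b p) (hk : k ≤ n)
    (hs : IsSignResponse a s) (hr : IsSignResponse b r) :
    (n % 4 = 0 ∧ s = 1 ∧ r = 1) ∨ (n % 4 = 1 ∧ s = 1 ∧ r = -1) ∨
      (n % 4 = 2 ∧ s = -1 ∧ r = -1) ∨ (n % 4 = 3 ∧ s = -1 ∧ r = 1) := by
  have hkn : (k : ℝ) ≤ n := by exact_mod_cast hk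
  have hk0 : (0 : ℝ) ≤ k := k.cast_nonneg
  rcases h with ⟨hn, ha, hb, -⟩ | ⟨hn, ha, hb, -⟩ | ⟨hn, ha, hb, -⟩ | ⟨hn, ha, hb, -⟩
  · exact .inl ⟨hn, hs.1 (by linarith), hr.1 (by linarith)⟩
  · exact .inr (.inl ⟨hn, hs.1 (by linarith), hr.2 (by linarith)⟩)
  · exact .inr (.inr (.inl ⟨hn, hs.2 (by linarith), hr.2 (by linarith)⟩))
  · exact .inr (.inr (.inr ⟨hn, hs.2 (by linarith), hr.1 (by linarith)⟩))

lemma PhaseState.step {n k : ℕ} {a b p s r : ℝ} (h : PhaseState n k a b p) (hk : k ≤ n)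
    (hs : IsSignResponse a s) (hr : IsSignResponse b r) :
    PhaseState n (k + 1) (a + 2 * r) (b - 2 * s) (p + s * r) := by
  have hsign := h.signs hk hs hr
  unfold PhaseState at h ⊢
  push_cast
  rcases hsign with ⟨hn, rfl, rfl⟩ | ⟨hn, rfl, rfl⟩ | ⟨hn, rfl, rfl⟩ | ⟨hn, rfl, rfl⟩ <;>
    simp only [hn] at h ⊢ <;> norm_num at h ⊢ <;> obtain ⟨ha, hb, hp⟩ := h <;>
    refine ⟨?_, ?_, ?_⟩ <;> linarith

/-- Overrunning a phase by one step is the same as starting the next phase. -/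
lemma PhaseState.next {n : ℕ} {a b p : ℝ} (h : PhaseState n (n + 1) a b p) :
    PhaseState (n + 1) 0 a b p := by
  unfold PhaseState at h ⊢
  push_cast at h ⊢
  rcases h with ⟨hn, ha, hb, hp⟩ | ⟨hn, ha, hb, hp⟩ | ⟨hn, ha, hb, hp⟩ | ⟨hn, ha, hb, hp⟩
  · exact .inr (.inl ⟨by omega, by linarith, by linarith, by linarith⟩)
  · exact .inr (.inr (.inl ⟨by omega, by linarith, by linarith, by linarith⟩))
  · exact .inr (.inr (.inr ⟨by omega, by linarith, by linarith, by linarith⟩))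
  · exact .inl ⟨by omega, by linarith, by linarith, by linarith⟩

lemma PhaseState.regret_bounds {n k : ℕ} {a b p : ℝ} (h : PhaseState n (k + 1) a b p)
    (hk : k ≤ n) :
    ((n : ℝ) - 1) / 2 ≤ |(a - 1) / 2| - p ∧ |(a - 1) / 2| - p ≤ ((n : ℝ) + 3) / 2 := by
  have hkn : (k : ℝ) ≤ n := by exact_mod_cast hk
  have hk0 : (0 : ℝ) ≤ k := k.cast_nonneg
  unfold PhaseState at h
  push_cast at h
  rcases h with ⟨-, ha, -, hp⟩ | ⟨-, ha, -, hp⟩ | ⟨-, ha, -, hp⟩ | ⟨-, ha, -, hp⟩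
  · rcases abs_cases ((a - 1) / 2) with ⟨h, h'⟩ | ⟨h, h'⟩ <;> rw [h] <;>
      constructor <;> linarith
  · rcases hk.eq_or_lt with rfl | hlt
    · rw [abs_of_nonpos (by linarith)]
      constructor <;> linarith
    · have : (k : ℝ) + 1 ≤ n := by exact_mod_cast hlt
      rw [abs_of_nonneg (by linarith)]
      constructor <;> linarith
  · rw [abs_of_nonpos (by linarith)]
    constructor <;> linarith
  · rcases abs_cases ((a - 1) / 2) with ⟨h, h'⟩ | ⟨h, h'⟩ <;> rw [h] <;>
      constructor <;> linarith

section MatchingPennies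

variable {y10 y20 : Fin 2 → ℝ} (g : GD2 !![(1 : ℝ), -1; -1, 1] 1 y10 y20)

lemma GD2.y1_sub_succ (t : ℕ) :
    g.y1 (t + 1) 0 - g.y1 (t + 1) 1 = g.y1 t 0 - g.y1 t 1 + 2 * (g.x2 t 0 - g.x2 t 1) := by
  simp [g.y1_succ, dotProduct, Fin.sum_univ_two]
  ring

lemma GD2.y2_sub_succ (t : ℕ) :
    g.y2 (t + 1) 0 - g.y2 (t + 1) 1 = g.y2 t 0 - g.y2 t 1 - 2 * (g.x1 t 0 - g.x1 t 1) := by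
  simp [g.y2_succ]
  ring

lemma GD2.sum_x2_sub (t : ℕ) :
    ∑ i ∈ range t, (g.x2 i 0 - g.x2 i 1) =
      ((g.y1 t 0 - g.y1 t 1) - (y10 0 - y10 1)) / 2 := by
  induction t with
  | zero => simp [g.y1_zero]
  | succ t ih => rw [sum_range_succ, ih, g.y1_sub_succ]; ring

/-- At iteration `t` the dynamics is at step `k` of phase `n`. -/
def GD2.InPhase (n k t : ℕ) : Prop :=
  PhaseState n k (g.y1 t 0 - g.y1 t 1) (g.y2 t 0 - g.y2 t 1)
    (∑ i ∈ range t, (g.x1 i 0 - g.x1 i 1) * (g.x2 i 0 - g.x2 i 1))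

variable {g} in
lemma GD2.InPhase.succ {n k t : ℕ} (h : g.InPhase n k t) (hk : k ≤ n) :
    g.InPhase n (k + 1) (t + 1) := by
  unfold GD2.InPhase
  rw [sum_range_succ, g.y1_sub_succ, g.y2_sub_succ]
  exact PhaseState.step h hk (g.x1_argmax t).isSignResponse (g.x2_argmax t).isSignResponse

variable {g} in
lemma GD2.InPhase.add {n t : ℕ} (h : g.InPhase n 0 t) {k : ℕ} (hk : k ≤ n + 1) :
    g.InPhase n k (t + k) := by
  induction k with
  | zero => exact h
  | succ k ih => exact (ih (by omega)).succ (by omega)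

end MatchingPennies

lemma GD2.inPhase_triangular (g : GD2 !![(1 : ℝ), -1; -1, 1] 1 ![1, 0] ![1, 0]) (n : ℕ) :
    g.InPhase n 0 (n * (n + 1) / 2) := by
  induction n with
  | zero => simp [GD2.InPhase, PhaseState, g.y1_zero, g.y2_zero]
  | succ n ih =>
    have ht : (n + 1) * (n + 1 + 1) / 2 = n * (n + 1) / 2 + (n + 1) := by
      rw [show (n + 1) * (n + 1 + 1) = n * (n + 1) + (n + 1) * 2 by ring,
        Nat.add_mul_div_right _ _ two_pos]
    rw [ht]
    exact PhaseState.next (ih.add le_rfl)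

/-- in Matching Pennies with `η = 1` and `y₁⁰ = y₂⁰ = (1,0)`, player 1's
regret at iteration `t = n(n+1)/2 + k` is between `(n−1)/2` and `(n+3)/2`. -/
theorem matching_pennies_regret_bounds
    (g : GD2 !![(1 : ℝ), -1; -1, 1] 1 ![1, 0] ![1, 0])
    (n k : ℕ) (hk : k ≤ n) :
    ((n : ℝ) - 1) / 2 ≤ regret1 !![(1 : ℝ), -1; -1, 1] g.x1 g.x2 (n * (n + 1) / 2 + k) ∧
    regret1 !![(1 : ℝ), -1; -1, 1] g.x1 g.x2 (n * (n + 1) / 2 + k) ≤ ((n : ℝ) + 3) / 2 := by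
  have h := (g.inPhase_triangular n).add (Nat.succ_le_succ hk)
  have hb := PhaseState.regret_bounds h hk
  rw [regret1_matchingPennies, g.sum_x2_sub]
  simpa [add_assoc] using hb
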